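/- Let G be a connected graph of order n > 3 with m edges. If the complement of G is 4-connected, then tmc(G) = m − n + 2 + l(G). -/

import Mathlib

open SimpleGraph

/-- A walk in a total-colored graph is *total monochromatic* if all of its edges and
internal vertices have the same color. -/
def IsTotalMonoWalk {V : Type*} {G : SimpleGraph V} (ce : Sym2 V → ℕ) (cv : V → ℕ)
    {u v : V} (w : G.Walk u v) : Prop :=
  ∃ c, (∀ e ∈ w.edges, ce e = c) ∧ ∀ x ∈ w.support.tail.dropLast, cv x = c

/-- A total coloring (edge coloring `ce`, vertex coloring `cv`) of `G` is a
*TMC-coloring* if any two vertices are connected by a total monochromatic path. -/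
def IsTMCColoring {V : Type*} (G : SimpleGraph V) (ce : Sym2 V → ℕ) (cv : V → ℕ) : Prop :=
  ∀ u v : V, u ≠ v → ∃ w : G.Walk u v, w.IsPath ∧ IsTotalMonoWalk ce cv w

/-- The number of colors used by a total coloring of `G`:
colors appearing on edges of `G` together with colors appearing on vertices. -/
noncomputable def colorsUsed {V : Type*} (G : SimpleGraph V) (ce : Sym2 V → ℕ) (cv : V → ℕ) : ℕ :=
  (ce '' G.edgeSet ∪ Set.range cv).ncard

/-- The total monochromatic connection number `tmc G`: the maximum number of colors
used in a TMC-coloring of `G`. -/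
noncomputable def tmc {V : Type*} [Fintype V] (G : SimpleGraph V) : ℕ :=
  sSup {k | ∃ ce cv, IsTMCColoring G ce cv ∧ colorsUsed G ce cv = k}

/-- The number of leaves (vertices of degree one) of a graph. -/
noncomputable def numLeaves {V : Type*} (T : SimpleGraph V) : ℕ :=
  {v : V | (T.neighborSet v).ncard = 1}.ncard

/-- `maxLeaves G` is the maximum number of leaves over all spanning trees of `G`. -/
noncomputable def maxLeaves {V : Type*} [Fintype V] (G : SimpleGraph V) : ℕ :=
  sSup {k | ∃ T : SimpleGraph V, T ≤ G ∧ T.IsTree ∧ numLeaves T = k}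

/-- A graph is `k`-connected if it has more than `k` vertices and removing any set of
fewer than `k` vertices leaves a connected graph. -/
def IsKConnected {V : Type*} [Fintype V] (G : SimpleGraph V) (k : ℕ) : Prop :=
  k < Fintype.card V ∧ ∀ S : Set V, S.ncard < k → (G.induce (Sᶜ : Set V)).Connected

/-- The graph `G` with all edges not inside `C` removed. -/
def restrictTo {V : Type*} (G : SimpleGraph V) (C : Finset V) : SimpleGraph V where
  Adj u v := G.Adj u v ∧ u ∈ C ∧ v ∈ C
  symm := ⟨fun _ _ h => ⟨h.1.symm, h.2.2, h.2.1⟩⟩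
  loopless := ⟨fun _ h => G.loopless.irrefl _ h.1⟩

lemma maxLeaves_bdd {V : Type*} [Fintype V] (G : SimpleGraph V) :
    BddAbove {k | ∃ T : SimpleGraph V, T ≤ G ∧ T.IsTree ∧ numLeaves T = k} := by
  refine ⟨Fintype.card V, ?_⟩
  rintro k ⟨T, -, -, rfl⟩
  unfold numLeaves
  rw [← Nat.card_eq_fintype_card, ← Set.ncard_univ]
  exact Set.ncard_le_ncard (Set.subset_univ _)

lemma leaves_of_dominating {V : Type*} [Fintype V] (G : SimpleGraph V)
    (hn : 3 < Fintype.card V) (C : Finset V) (r : V) (hr : r ∈ C)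
    (hC : ∀ x ∈ C, (restrictTo G C).Reachable r x)
    (hdom : ∀ y, y ∉ C → ∃ x ∈ C, G.Adj x y) :
    Fintype.card V ≤ maxLeaves G + C.card := by
  classical
  choose! f hf using hdom
  let H : SimpleGraph V :=
    { Adj := fun u v => G.Adj u v ∧ ((u ∈ C ∧ v ∈ C) ∨ (u ∉ C ∧ v = f u) ∨ (v ∉ C ∧ u = f v))
      symm := ⟨fun u v h => ⟨h.1.symm, by tauto⟩⟩
      loopless := ⟨fun _ h => G.loopless.irrefl _ h.1⟩ }
  have hle : restrictTo G C ≤ H := fun u v h => ⟨h.1, Or.inl h.2⟩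
  have hreach : ∀ x, H.Reachable r x := by
    intro x
    by_cases hx : x ∈ C
    · exact (hC x hx).mono hle
    · refine ((hC _ (hf x hx).1).mono hle).trans (SimpleGraph.Adj.reachable ?_)
      exact ⟨(hf x hx).2, Or.inr (Or.inr ⟨hx, rfl⟩)⟩
  have hHc : H.Connected := by
    have : Nonempty V := ⟨r⟩
    exact ⟨fun x y => (hreach x).symm.trans (hreach y)⟩
  obtain ⟨T, hT, hTt⟩ := hHc.exists_isTree_le
  have : Nontrivial V := Fintype.one_lt_card_iff_nontrivial.mp (by omega)
  have hl : ((Cᶜ : Finset V) : Set V) ⊆ {v : V | (T.neighborSet v).ncard = 1} := by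
    intro v hv
    have hv' : v ∉ C := by simpa using hv
    simp only [Set.mem_ofPred_eq]
    rw [Set.ncard_eq_one]
    have hsub : ∀ w, T.Adj v w → w = f v := by
      intro w hw
      rcases (hT hw).2 with h | h | h
      · exact absurd h.1 hv'
      · exact h.2
      · exact absurd (h.2 ▸ (hf w h.1).1) hv'
    obtain ⟨w, hw⟩ := hTt.connected.preconnected.exists_adj_of_nontrivial v
    refine ⟨f v, ?_⟩
    ext w'
    simp only [SimpleGraph.mem_neighborSet, Set.mem_singleton_iff]
    refine ⟨hsub w', fun h => ?_⟩
    rw [h, ← hsub w hw]; exact hw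
  have h1 : numLeaves T ≤ maxLeaves G :=
    le_csSup (maxLeaves_bdd G) ⟨T, hT.trans (fun _ _ h => h.1), hTt, rfl⟩
  have h2 : (Cᶜ : Finset V).card ≤ numLeaves T := by
    rw [← Set.ncard_coe_finset]
    exact Set.ncard_le_ncard hl
  rw [Finset.card_compl] at h2
  omega

/-- Counting in a connected hypergraph. -/
lemma hyper_count {V J : Type*} [Fintype V] [Fintype J] [DecidableEq V] [DecidableEq J]
    (D : J → Finset V) (W : Finset V) (hDW : ∀ j, D j ⊆ W) (j0 : J) (h0 : (D j0).Nonempty)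
    (hcross : ∀ S : Finset V, S ⊆ W → S.Nonempty → S ≠ W →
      ∃ j, ∃ x ∈ S, ∃ y ∈ W, y ∉ S ∧ x ∈ D j ∧ y ∈ D j) :
    W.card ≤ (D j0).card + ∑ j ∈ Finset.univ.erase j0, ((D j).card - 1) := by
  let P : Finset (Finset J) := Finset.univ.filter fun F => j0 ∈ F ∧
    (F.biUnion D).card ≤ (D j0).card + ∑ j ∈ F.erase j0, ((D j).card - 1)
  have hP : P.Nonempty := ⟨{j0}, by simp [P]⟩
  obtain ⟨F, hF⟩ := P.exists_maximal hP
  have hFP := hF.1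
  simp only [P, Finset.mem_filter, Finset.mem_univ, true_and] at hFP
  by_cases hU : F.biUnion D = W
  · rw [← hU]
    refine hFP.2.trans ?_
    gcongr
    exact Finset.subset_univ _
  · exfalso
    obtain ⟨j, x, hx, y, hy, hyS, hxj, hyj⟩ := hcross (F.biUnion D)
      (Finset.biUnion_subset.mpr fun j _ => hDW j)
      (h0.mono (Finset.subset_biUnion_of_mem D hFP.1)) hU
    have hjF : j ∉ F := fun h => hyS (Finset.mem_biUnion.mpr ⟨j, h, hyj⟩)
    have hj0 : j ≠ j0 := fun h => hjF (h ▸ hFP.1)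
    have hmem : insert j F ∈ P := by
      simp only [P, Finset.mem_filter, Finset.mem_univ, true_and]
      refine ⟨Finset.mem_insert_of_mem hFP.1, ?_⟩
      rw [Finset.biUnion_insert, Finset.erase_insert_of_ne hj0, Finset.sum_insert (by simp [hjF])]
      have h1 := Finset.card_union_add_card_inter (D j) (F.biUnion D)
      have h2 : 0 < (D j ∩ F.biUnion D).card :=
        Finset.card_pos.mpr ⟨x, Finset.mem_inter.mpr ⟨hxj, hx⟩⟩
      have := hFP.2
      omega
    exact hjF (hF.2 hmem (Finset.subset_insert j F) (Finset.mem_insert_self j F))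

lemma cross_of_conn {V : Type*} [Fintype V] [DecidableEq V] (H : SimpleGraph V) (Z : Finset V)
    (h : (H.induce ((Z : Set V)ᶜ)).Connected) (S : Finset V) (hS : S.Nonempty)
    (hSZ : S ⊆ Zᶜ) (hne : S ≠ Zᶜ) :
    ∃ x ∈ S, ∃ y ∈ Zᶜ, y ∉ S ∧ H.Adj x y := by
  obtain ⟨a, ha⟩ := hS
  obtain ⟨b, hb, hbS⟩ := Finset.exists_of_ssubset (hSZ.ssubset_of_ne hne)
  have ha' : a ∈ ((Z : Set V)ᶜ) := by simpa using hSZ ha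
  have hb' : b ∈ ((Z : Set V)ᶜ) := by simpa using hb
  obtain ⟨p⟩ := h.preconnected ⟨a, ha'⟩ ⟨b, hb'⟩
  obtain ⟨d, -, hd1, hd2⟩ := p.exists_boundary_dart {x | x.1 ∈ S} ha hbS
  refine ⟨d.fst.1, hd1, d.snd.1, ?_, hd2, d.adj⟩
  exact Finset.mem_compl.mpr fun h => d.snd.2 (Finset.mem_coe.mpr h)

lemma core {V J : Type*} [Fintype V] [Fintype J] [DecidableEq V] [DecidableEq J]
    (G : SimpleGraph V) (hn : 3 < Fintype.card V)
    (hc : ∀ Z : Finset V, Z.card < 4 → (Gᶜ.induce ((Z : Set V)ᶜ)).Connected)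
    (A D : J → Finset V) (hAD : ∀ j, A j ⊆ D j) (r : J → V) (hr : ∀ j, r j ∈ A j)
    (hconn : ∀ j, ∀ x ∈ A j, (restrictTo G (A j)).Reachable (r j) x)
    (hdom : ∀ j, ∀ y ∈ D j, y ∉ A j → ∃ x ∈ A j, G.Adj x y)
    (hcov : ∀ u v, Gᶜ.Adj u v → ∃ j, u ∈ D j ∧ v ∈ D j) :
    (2 * Fintype.card V : ℤ) ≤ ∑ j, (((D j).card : ℤ) + (A j).card - 2) + maxLeaves G + 2 := by
  have hA1 : ∀ j, 1 ≤ (A j).card := fun j => Finset.card_pos.mpr ⟨_, hr j⟩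
  have hDA : ∀ j, (A j).card ≤ (D j).card := fun j => Finset.card_le_card (hAD j)
  have hnn : ∀ j, (0 : ℤ) ≤ ((D j).card : ℤ) + (A j).card - 2 := by
    intro j; have := hA1 j; have := hDA j; omega
  by_cases hV : ∃ j, D j = Finset.univ
  · obtain ⟨j, hj⟩ := hV
    have h1 := leaves_of_dominating G hn (A j) (r j) (hr j) (hconn j)
      (fun y hy => hdom j y (by simp [hj]) hy)
    have h2 := Finset.single_le_sum (f := fun j => ((D j).card : ℤ) + (A j).card - 2)
      (fun j _ => hnn j) (Finset.mem_univ j)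
    simp only [hj, Finset.card_univ] at h2
    omega
  push Not at hV
  let L : J → Finset V := fun j => if (A j).card = 1 then D j \ A j else D j
  have hLD : ∀ j, L j ⊆ D j := by
    intro j; simp only [L]; split_ifs
    · exact Finset.sdiff_subset
    · exact subset_rfl
  have hLc : ∀ j, ((L j).card : ℤ) ≤ ((D j).card : ℤ) + (A j).card - 2 := by
    intro j; have h1 := hA1 j; have h2 := hDA j
    simp only [L]; split_ifs with h
    · rw [Finset.card_sdiff_of_subset (hAD j)]; omega
    · omega
  have hstar : ∀ j u v, (A j).card = 1 → u ∈ D j → v ∈ D j → Gᶜ.Adj u v → u ∉ A j := by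
    intro j u v hj hu hv huv huA
    obtain ⟨a, ha⟩ := Finset.card_eq_one.mp hj
    have hua : u = a := by simpa [ha] using huA
    subst hua
    have hne := huv.ne
    obtain ⟨x, hx, hxv⟩ := hdom j v hv (by simp [ha, hne.symm])
    have : x = u := by simpa [ha] using hx
    subst this
    exact ((SimpleGraph.compl_adj _ _ _).mp huv).2 hxv
  have hcovL : ∀ u v, Gᶜ.Adj u v → ∃ j, u ∈ L j ∧ v ∈ L j := by
    intro u v huv
    obtain ⟨j, hu, hv⟩ := hcov u v huv
    refine ⟨j, ?_⟩
    simp only [L]; split_ifs with h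
    · exact ⟨Finset.mem_sdiff.mpr ⟨hu, hstar j u v h hu hv huv⟩,
        Finset.mem_sdiff.mpr ⟨hv, hstar j v u h hv hu huv.symm⟩⟩
    · exact ⟨hu, hv⟩
  have hcross0 : ∀ S : Finset V, S.Nonempty → S ≠ Finset.univ →
      ∃ x ∈ S, ∃ y, y ∉ S ∧ Gᶜ.Adj x y := by
    intro S h1 h2
    obtain ⟨x, hx, y, -, hy⟩ := cross_of_conn Gᶜ ∅ (hc ∅ (by simp)) S h1 (by simp) (by simpa using h2)
    exact ⟨x, hx, y, hy⟩
  by_cases hall : ∀ v, 2 ≤ (Finset.univ.filter fun j => v ∈ L j).card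
  · have h1 : ∑ v : V, (Finset.univ.filter fun j => v ∈ L j).card = ∑ j, (L j).card := by
      have := Finset.sum_card_bipartiteAbove_eq_sum_card_bipartiteBelow
        (s := (Finset.univ : Finset V)) (t := (Finset.univ : Finset J)) (fun v j => v ∈ L j)
      simpa [Finset.bipartiteAbove, Finset.bipartiteBelow] using this
    have h2 : 2 * Fintype.card V ≤ ∑ j, (L j).card := by
      rw [← h1]
      calc 2 * Fintype.card V = ∑ v : V, 2 := by simp [mul_comm]
        _ ≤ _ := Finset.sum_le_sum fun v _ => hall v
    have h3 : ((∑ j, (L j).card : ℕ) : ℤ) ≤ ∑ j, (((D j).card : ℤ) + (A j).card - 2) := by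
      push_cast
      exact Finset.sum_le_sum fun j _ => hLc j
    omega
  push Not at hall
  obtain ⟨v, hv⟩ := hall
  obtain ⟨v', hv', w, -, hvw⟩ := hcross0 {v} (by simp) (by
    intro h
    have := congrArg Finset.card h
    simp at this; omega)
  obtain rfl : v' = v := by simpa using hv'
  rename' v' => v
  obtain ⟨j1, hvj, hwj⟩ := hcovL v w hvw
  have huniq : ∀ j, v ∈ L j → j = j1 := by
    intro j hj
    have := Finset.card_le_one.mp (Nat.lt_succ_iff.mp hv)
    exact this j (by simp [hj]) j1 (by simp [hvj])
  have hvD := hLD j1 hvj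
  have hwD := hLD j1 hwj
  have hvout : ∀ y, y ∉ D j1 → G.Adj v y := by
    intro y hy
    by_contra hcon
    have : Gᶜ.Adj v y := (SimpleGraph.compl_adj _ _ _).mpr ⟨fun h => hy (h ▸ hvD), hcon⟩
    obtain ⟨j, h1, h2⟩ := hcovL v y this
    obtain rfl := huniq j h1
    exact hy (hLD _ h2)
  have hleaf : Fintype.card V ≤ maxLeaves G + (insert v (A j1)).card := by
    have hmono : restrictTo G (A j1) ≤ restrictTo G (insert v (A j1)) := fun a b h =>
      ⟨h.1, Finset.mem_insert_of_mem h.2.1, Finset.mem_insert_of_mem h.2.2⟩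
    refine leaves_of_dominating G hn _ (r j1) (Finset.mem_insert_of_mem (hr j1)) ?_ ?_
    · intro x hx
      by_cases hxA : x ∈ A j1
      · exact (hconn j1 x hxA).mono hmono
      · obtain rfl : x = v := by simpa [hxA] using hx
        obtain ⟨a, ha, hax⟩ := hdom j1 x hvD hxA
        exact ((hconn j1 a ha).mono hmono).trans
          (SimpleGraph.Adj.reachable ⟨hax, Finset.mem_insert_of_mem ha, hx⟩)
    · intro y hy
      by_cases hyD : y ∈ D j1
      · obtain ⟨x, hx, h⟩ := hdom j1 y hyD (fun h => hy (Finset.mem_insert_of_mem h))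
        exact ⟨x, Finset.mem_insert_of_mem hx, h⟩
      · exact ⟨v, Finset.mem_insert_self _ _, hvout y hyD⟩
  have hins := Finset.card_insert_le v (A j1)
  obtain ⟨z, hz, y, hy, hzy⟩ := hcross0 (D j1) ⟨v, hvD⟩ (hV j1)
  obtain ⟨j2, hzj2, hyj2⟩ := hcov z y hzy
  have hj21 : j2 ≠ j1 := fun h => hy (h ▸ hyj2)
  have hcount := hyper_count (fun j => (D j).erase z) (Finset.univ.erase z)
    (fun j => Finset.erase_subset_erase _ (Finset.subset_univ _)) j1 (by
      by_cases h : v = z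
      · exact ⟨w, Finset.mem_erase.mpr ⟨fun h' => hvw.ne (h.trans h'.symm), hwD⟩⟩
      · exact ⟨v, Finset.mem_erase.mpr ⟨h, hvD⟩⟩) (by
      intro S h1 h2 h3
      have hzc : ({z} : Finset V)ᶜ = Finset.univ.erase z := by ext; simp
      obtain ⟨a, ha, b, hb, hbS, hab⟩ := cross_of_conn Gᶜ {z} (hc {z} (by simp)) S h2
        (by rw [hzc]; exact h1) (by rw [hzc]; exact h3)
      obtain ⟨j, hj⟩ := hcov a b hab
      have haz : a ≠ z := (Finset.mem_erase.mp (h1 ha)).1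
      have hbz : b ≠ z := by simpa using hb
      exact ⟨j, a, ha, b, by simp [hbz], hbS, by simp [haz, hj.1], by simp [hbz, hj.2]⟩)
  have hcz : (Finset.univ.erase z : Finset V).card = Fintype.card V - 1 := by
    rw [Finset.card_erase_of_mem (Finset.mem_univ _), Finset.card_univ]
  have hc1 : ((D j1).erase z).card = (D j1).card - 1 := Finset.card_erase_of_mem hz
  have hc2 : ((D j2).erase z).card = (D j2).card - 1 := Finset.card_erase_of_mem hzj2
  have hD2 : 2 ≤ (D j2).card := Finset.one_lt_card.mpr ⟨z, hzj2, y, hyj2, hzy.ne⟩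
  have hD1 : 1 ≤ (D j1).card := Finset.card_pos.mpr ⟨v, hvD⟩
  have hj2mem : j2 ∈ Finset.univ.erase j1 := by simp [hj21]
  rw [← Finset.add_sum_erase _ _ hj2mem] at hcount
  have hsum : ((∑ j ∈ (Finset.univ.erase j1).erase j2, (((D j).erase z).card - 1) : ℕ) : ℤ) ≤
      ∑ j ∈ (Finset.univ.erase j1).erase j2, (((D j).card : ℤ) + (A j).card - 2) := by
    push_cast
    refine Finset.sum_le_sum fun j _ => ?_
    have h1 := hA1 j
    have h2 := hDA j
    have h3 : ((D j).erase z).card ≤ (D j).card := Finset.card_le_card (Finset.erase_subset _ _)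
    omega
  rw [← Finset.add_sum_erase _ _ (Finset.mem_univ j1), ← Finset.add_sum_erase _ _ hj2mem]
  have := hA1 j2
  simp only [hcz, hc1, hc2] at hcount
  omega

/-- Edges whose color agrees with both endpoints. -/
def monoGraph {V : Type*} (G : SimpleGraph V) (ce : Sym2 V → ℕ) (cv : V → ℕ) : SimpleGraph V where
  Adj u v := G.Adj u v ∧ cv u = cv v ∧ ce s(u, v) = cv u
  symm := ⟨fun u v h => ⟨h.1.symm, h.2.1.symm, by rw [Sym2.eq_swap, h.2.2, h.2.1]⟩⟩
  loopless := ⟨fun _ h => G.loopless.irrefl _ h.1⟩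

lemma mono_color {V : Type*} (G : SimpleGraph V) (ce : Sym2 V → ℕ) (cv : V → ℕ) {a b : V}
    (h : (monoGraph G ce cv).Reachable a b) : cv a = cv b := by
  obtain ⟨p⟩ := h
  induction p with
  | nil => rfl
  | cons h p ih => exact h.2.1.trans ih

lemma walk_mono {V : Type*} (G : SimpleGraph V) (ce : Sym2 V → ℕ) (cv : V → ℕ) {x v : V}
    (q : G.Walk x v) (c : ℕ) (hq : ¬ q.Nil) (he : ∀ e ∈ q.edges, ce e = c)
    (hs : ∀ y ∈ q.support.dropLast, cv y = c) :
    ∃ a, (monoGraph G ce cv).Reachable x a ∧ G.Adj a v ∧ ce s(a, v) = cv a := by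
  induction q with
  | nil => simp at hq
  | @cons u w v h p ih =>
    have hu : cv u = c := hs u (by
      rw [SimpleGraph.Walk.support_cons, List.dropLast_cons_of_ne_nil p.support_ne_nil]; simp)
    have huw : ce s(u, w) = c := he _ (by simp)
    by_cases hp : p.Nil
    · cases p with
      | nil => exact ⟨u, SimpleGraph.Reachable.refl _, h, by rw [huw, hu]⟩
      | cons h' p' => simp at hp
    · have hs' : ∀ y ∈ p.support.dropLast, cv y = c := by
        intro y hy
        apply hs
        rw [SimpleGraph.Walk.support_cons, List.dropLast_cons_of_ne_nil p.support_ne_nil]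
        exact List.mem_cons_of_mem _ hy
      have hw : cv w = c := hs' w (by
        cases p with
        | nil => simp at hp
        | cons h' p' =>
          rw [SimpleGraph.Walk.support_cons, List.dropLast_cons_of_ne_nil p'.support_ne_nil]; simp)
      obtain ⟨a, ha, h2⟩ := ih hp (fun e he' => he e (by simp [he'])) hs'
      refine ⟨a, ?_, h2⟩
      have : (monoGraph G ce cv).Adj u w := ⟨h, by rw [hu, hw], by rw [huw, hu]⟩
      exact this.reachable.trans ha

lemma upper {V : Type*} [Fintype V] (G : SimpleGraph V)
    (hn : 3 < Fintype.card V) (hcompl : IsKConnected Gᶜ 4) (ce : Sym2 V → ℕ) (cv : V → ℕ)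
    (hcol : IsTMCColoring G ce cv) :
    (colorsUsed G ce cv : ℤ) ≤
      (G.edgeSet.ncard : ℤ) - (Fintype.card V : ℤ) + 2 + (maxLeaves G : ℤ) := by
  classical
  let K := monoGraph G ce cv
  let J := K.ConnectedComponent
  let mk : V → J := K.connectedComponentMk
  have hmk : ∀ {a b}, mk a = mk b ↔ K.Reachable a b := SimpleGraph.ConnectedComponent.eq
  let _ : Fintype J := Fintype.ofFinite J
  let r : J → V := fun j => j.exists_rep.choose
  have hrj : ∀ j, mk (r j) = j := fun j => j.exists_rep.choose_spec
  let A : J → Finset V := fun j => Finset.univ.filter fun x => mk x = j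
  let D : J → Finset V := fun j => Finset.univ.filter fun y => mk y = j ∨
    ∃ x, mk x = j ∧ G.Adj x y ∧ ce s(x, y) = cv x
  let E : J → Finset (Sym2 V) := fun j => G.edgeFinset.filter fun e =>
    ∃ x y, e = s(x, y) ∧ mk x = j ∧ ce e = cv x
  have hr : ∀ j, r j ∈ A j := fun j => by simp [A, hrj]
  have hAD : ∀ j, A j ⊆ D j := by
    intro j x hx
    simp only [A, D, Finset.mem_filter, Finset.mem_univ, true_and] at hx ⊢
    exact Or.inl hx
  have hcore := core G hn (by
      intro Z hZ
      exact hcompl.2 Z (by rwa [Set.ncard_coe_finset])) A D hAD r hr (by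
      intro j x hx
      have hx' : mk x = j := by simpa [A] using hx
      have hre : K.Reachable (r j) x := hmk.mp ((hrj j).trans hx'.symm)
      have hrA := hr j
      obtain ⟨p⟩ := hre
      have key : ∀ (a b : V) (p : K.Walk a b), a ∈ A j → (restrictTo G (A j)).Reachable a b := by
        intro a b p
        induction p with
        | nil => intro _; exact SimpleGraph.Reachable.refl _
        | @cons u v w h p ih =>
          intro hu
          have hv : v ∈ A j := by
            simp only [A, Finset.mem_filter, Finset.mem_univ, true_and] at hu ⊢
            rw [← hu]; exact hmk.mpr h.symm.reachable
          have hadj : (restrictTo G (A j)).Adj u v := ⟨h.1, hu, hv⟩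
          exact hadj.reachable.trans (ih hv)
      exact key _ _ p hrA) (by
      intro j y hy hyA
      simp only [A, D, Finset.mem_filter, Finset.mem_univ, true_and] at hy hyA ⊢
      obtain ⟨x, h1, h2, -⟩ := hy.resolve_left hyA
      exact ⟨x, h1, h2⟩) (by
      intro u v huv
      obtain ⟨w, -, c, he, hs⟩ := hcol u v huv.ne
      have hnadj : ¬ G.Adj u v := ((SimpleGraph.compl_adj _ _ _).mp huv).2
      cases w with
      | nil => exact absurd rfl huv.ne
      | @cons _ x _ h p =>
        have hp : ¬ p.Nil := by
          intro hp
          cases p with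
          | nil => exact hnadj h
          | cons h' p' => simp at hp
        have hs' : ∀ y ∈ p.support.dropLast, cv y = c := by
          intro y hy; exact hs y (by simpa using hy)
        obtain ⟨a, ha, h1, h2⟩ := walk_mono G ce cv p c hp (fun e he' => he e (by simp [he'])) hs'
        have hx : cv x = c := hs' x (by
          cases p with
          | nil => simp at hp
          | cons h' p' =>
            rw [SimpleGraph.Walk.support_cons, List.dropLast_cons_of_ne_nil p'.support_ne_nil]
            simp)
        refine ⟨mk x, ?_, ?_⟩
        · simp only [D, Finset.mem_filter, Finset.mem_univ, true_and]
          refine Or.inr ⟨x, rfl, h.symm, ?_⟩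
          rw [Sym2.eq_swap, hx]; exact he _ (by simp)
        · simp only [D, Finset.mem_filter, Finset.mem_univ, true_and]
          exact Or.inr ⟨a, hmk.mpr ha.symm, h1, h2⟩)
  have hsumA : ∑ j, (A j).card = Fintype.card V := by
    rw [← Finset.card_univ]
    exact (Finset.card_eq_sum_card_fiberwise (f := mk) (fun _ _ => Finset.mem_coe.mpr (Finset.mem_univ _))).symm
  -- edge counting
  have hE : ∀ j, (D j).card ≤ (E j).card + 1 := by
    intro j
    let M : SimpleGraph (D j) :=
      { Adj := fun u v => s(u.1, v.1) ∈ E j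
        symm := ⟨fun u v h => by rw [Sym2.eq_swap]; exact h⟩
        loopless := ⟨fun u h => by simp [E] at h⟩ }
    have hedge : ∀ (x y : V) (hx : x ∈ D j) (hy : y ∈ D j), mk x = j → G.Adj x y →
        ce s(x, y) = cv x → M.Adj ⟨x, hx⟩ ⟨y, hy⟩ := by
      intro x y hx hy h1 h2 h3
      change s(x, y) ∈ E j
      simp only [E, Finset.mem_filter, SimpleGraph.mem_edgeFinset, SimpleGraph.mem_edgeSet]
      exact ⟨h2, x, y, rfl, h1, h3⟩
    have key : ∀ (a b : V) (p : K.Walk a b) (ha : mk a = j) (hb : mk b = j),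
        M.Reachable ⟨a, hAD j (by simpa [A] using ha)⟩ ⟨b, hAD j (by simpa [A] using hb)⟩ := by
      intro a b p
      induction p with
      | nil => intro _ _; exact SimpleGraph.Reachable.refl _
      | @cons u v w h p ih =>
        intro hu hw
        have hv : mk v = j := by rw [← hu]; exact hmk.mpr h.symm.reachable
        exact (hedge u v _ (hAD j (by simpa [A] using hv)) hu h.1 h.2.2).reachable.trans (ih hv hw)
    have hreach : ∀ y : D j, M.Reachable ⟨r j, hAD j (hr j)⟩ y := by
      rintro ⟨y, hy⟩
      have hy' := hy
      simp only [D, Finset.mem_filter, Finset.mem_univ, true_and] at hy'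
      rcases hy' with h | ⟨x, h1, h2, h3⟩
      · obtain ⟨p⟩ := hmk.mp ((hrj j).trans h.symm)
        exact key _ _ p (hrj j) h
      · obtain ⟨p⟩ := hmk.mp ((hrj j).trans h1.symm)
        exact (key _ _ p (hrj j) h1).trans (hedge x y _ hy h1 h2 h3).reachable
    have hMc : M.Connected := by
      have : Nonempty (D j) := ⟨⟨r j, hAD j (hr j)⟩⟩
      exact ⟨fun x y => (hreach x).symm.trans (hreach y)⟩
    have h1 := hMc.card_vert_le_card_edgeSet_add_one
    have h2 : Nat.card M.edgeSet ≤ (E j).card := by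
      have hinj : Function.Injective (fun e : M.edgeSet => (⟨Sym2.map Subtype.val e.1, by
          obtain ⟨e, he⟩ := e
          induction e using Sym2.ind with
          | _ a b => exact he⟩ : (E j))) := by
        intro e e' h
        exact Subtype.ext (Sym2.map.injective Subtype.val_injective (congrArg Subtype.val h))
      have := Nat.card_le_card_of_injective _ hinj
      simpa using this
    simp only [Nat.card_eq_fintype_card, Fintype.card_coe] at h1 h2
    omega
  have hEdisj : ((Finset.univ : Finset J) : Set J).PairwiseDisjoint E := by
    intro i _ j _ hij
    rw [Function.onFun, Finset.disjoint_left]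
    intro e hei hej
    simp only [E, Finset.mem_filter, SimpleGraph.mem_edgeFinset] at hei hej
    obtain ⟨heG, x, y, rfl, hx, hcx⟩ := hei
    obtain ⟨-, x', y', hxy, hx', hcx'⟩ := hej
    apply hij
    rw [← hx, ← hx']
    rcases Sym2.eq_iff.mp hxy with ⟨h, -⟩ | ⟨h, h'⟩
    · rw [h]
    · subst h'
      exact hmk.mpr (SimpleGraph.Adj.reachable ⟨heG, hcx.symm.trans hcx', hcx⟩)
  let R : Finset (Sym2 V) := G.edgeFinset \ Finset.univ.biUnion E
  have hRc : R.card + ∑ j, (E j).card = G.edgeSet.ncard := by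
    rw [← Finset.card_biUnion hEdisj, ← SimpleGraph.coe_edgeFinset, Set.ncard_coe_finset]
    refine Finset.card_sdiff_add_card_eq_card ?_
    refine Finset.biUnion_subset.mpr fun j _ => Finset.filter_subset _ _
  have hsub : ce '' G.edgeSet ∪ Set.range cv ⊆
      ((R.image ce ∪ Finset.univ.image (fun j => cv (r j)) : Finset ℕ) : Set ℕ) := by
    have hcr : ∀ x, cv (r (mk x)) = cv x := fun x => mono_color G ce cv (hmk.mp (hrj _))
    rintro c (⟨e, he, rfl⟩ | ⟨x, rfl⟩)
    · rw [Finset.mem_coe, Finset.mem_union]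
      by_cases heR : e ∈ R
      · exact Or.inl (Finset.mem_image_of_mem _ heR)
      · right
        have : e ∈ Finset.univ.biUnion E := by
          by_contra hcon
          exact heR (Finset.mem_sdiff.mpr ⟨SimpleGraph.mem_edgeFinset.mpr he, hcon⟩)
        obtain ⟨j, -, hj⟩ := Finset.mem_biUnion.mp this
        simp only [E, Finset.mem_filter] at hj
        obtain ⟨-, x, y, -, -, h⟩ := hj
        rw [h, ← hcr x]
        exact Finset.mem_image_of_mem (fun j => cv (r j)) (Finset.mem_univ _)
    · rw [Finset.mem_coe, Finset.mem_union]
      right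
      rw [← hcr x]
      exact Finset.mem_image_of_mem (fun j => cv (r j)) (Finset.mem_univ _)
  have hcu : colorsUsed G ce cv ≤ R.card + Fintype.card J := by
    unfold colorsUsed
    refine (Set.ncard_le_ncard hsub (Finset.finite_toSet _)).trans ?_
    rw [Set.ncard_coe_finset]
    refine (Finset.card_union_le _ _).trans (add_le_add Finset.card_image_le ?_)
    exact Finset.card_image_le
  have hsD : ∑ j, (D j).card ≤ ∑ j, (E j).card + Fintype.card J := by
    calc ∑ j, (D j).card ≤ ∑ j, ((E j).card + 1) := Finset.sum_le_sum fun j _ => hE j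
      _ = _ := by simp [Finset.sum_add_distrib]
  have hexp : ∑ j, (((D j).card : ℤ) + (A j).card - 2) =
      ((∑ j, (D j).card : ℕ) : ℤ) + ((∑ j, (A j).card : ℕ) : ℤ) - 2 * Fintype.card J := by
    push_cast
    rw [Finset.sum_sub_distrib, Finset.sum_add_distrib]
    simp [mul_comm]
  rw [hexp, hsumA] at hcore
  omega

lemma lower {V : Type*} [Fintype V] (G : SimpleGraph V) (hn : 3 < Fintype.card V)
    (T : SimpleGraph V) (hTG : T ≤ G) (hT : T.IsTree) :
    ∃ ce cv, IsTMCColoring G ce cv ∧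
      (G.edgeSet.ncard : ℤ) - (Fintype.card V : ℤ) + 2 + (numLeaves T : ℤ) ≤
        colorsUsed G ce cv := by
  classical
  have : Nontrivial V := Fintype.one_lt_card_iff_nontrivial.mp (by omega)
  obtain ⟨φ, hφ⟩ : ∃ φ : V ⊕ Sym2 V → ℕ, Function.Injective φ :=
    Countable.exists_injective_nat _
  let leaf : V → Prop := fun v => (T.neighborSet v).ncard = 1
  let ce : Sym2 V → ℕ := fun e => if e ∈ T.edgeSet then 0 else φ (Sum.inr e) + 1
  let cv : V → ℕ := fun v => if leaf v then φ (Sum.inl v) + 1 else 0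
  refine ⟨ce, cv, ?_, ?_⟩
  · intro u v huv
    obtain ⟨p, hp⟩ := hT.connected.preconnected.exists_isPath u v
    refine ⟨p.mapLe hTG, (SimpleGraph.Walk.isPath_mapLe hTG).mpr hp, 0, ?_, ?_⟩
    · intro e he
      rw [SimpleGraph.Walk.edges_mapLe_eq_edges] at he
      simp only [ce]
      rw [if_pos (p.edges_subset_edgeSet he)]
    · intro x hx
      rw [SimpleGraph.Walk.support_mapLe_eq_support] at hx
      simp only [cv]
      rw [if_neg]
      intro hleaf
      obtain ⟨a, ha⟩ := Set.ncard_eq_one.mp hleaf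
      obtain ⟨i, hi, hix⟩ := List.getElem_of_mem hx
      simp only [List.length_dropLast, List.length_tail, SimpleGraph.Walk.length_support] at hi
      rw [List.getElem_dropLast, List.getElem_tail, SimpleGraph.Walk.support_getElem_eq_getVert] at hix
      have h1 := p.adj_getVert_succ (i := i) (by omega)
      have h2 := p.adj_getVert_succ (i := i + 1) (by omega)
      rw [hix] at h1 h2
      have e1 : p.getVert i ∈ T.neighborSet x := h1.symm
      have e2 : p.getVert (i + 1 + 1) ∈ T.neighborSet x := h2
      rw [ha, Set.mem_singleton_iff] at e1 e2
      have := hp.getVert_injOn (x₁ := i) (x₂ := i + 1 + 1) (by simp; omega) (by simp; omega)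
        (e1.trans e2.symm)
      omega
  · let Lf : Finset V := Finset.univ.filter leaf
    let Rf : Finset (Sym2 V) := G.edgeFinset \ T.edgeFinset
    let X : Finset (V ⊕ Sym2 V) := Lf.disjSum Rf
    have hX : X.card = Lf.card + Rf.card := Finset.card_disjSum _ _
    have hLf : Lf.card = numLeaves T := by
      unfold numLeaves
      rw [← Set.ncard_coe_finset]
      congr 1
      ext v
      simp [Lf, leaf]
    have hRf : Rf.card + T.edgeFinset.card = G.edgeSet.ncard := by
      rw [← SimpleGraph.coe_edgeFinset, Set.ncard_coe_finset]
      exact Finset.card_sdiff_add_card_eq_card (SimpleGraph.edgeFinset_mono hTG)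
    have hTe := hT.card_edgeFinset
    let Y : Finset ℕ := insert 0 (X.image fun x => φ x + 1)
    have hY : Y.card = X.card + 1 := by
      rw [Finset.card_insert_of_notMem (by simp), Finset.card_image_of_injective]
      intro a b hab
      exact hφ (by simpa using hab)
    have hsub : (Y : Set ℕ) ⊆ ce '' G.edgeSet ∪ Set.range cv := by
      intro c hc
      rw [Finset.mem_coe, Finset.mem_insert, Finset.mem_image] at hc
      rcases hc with rfl | ⟨x, hx, rfl⟩
      · left
        obtain ⟨v⟩ := hT.connected.nonempty
        obtain ⟨w, hw⟩ := hT.connected.preconnected.exists_adj_of_nontrivial v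
        exact ⟨s(v, w), hTG hw, if_pos hw⟩
      · rcases x with v | e
        · right
          refine ⟨v, if_pos ?_⟩
          simpa [X, Lf] using hx
        · left
          have he : e ∈ Rf := by simpa [X] using hx
          simp only [Rf, Finset.mem_sdiff, SimpleGraph.mem_edgeFinset] at he
          exact ⟨e, he.1, if_neg he.2⟩
    have hfin : (ce '' G.edgeSet ∪ Set.range cv).Finite :=
      (Set.toFinite _).union (Set.finite_range _)
    have h := Set.ncard_le_ncard hsub hfin
    rw [Set.ncard_coe_finset] at h
    unfold colorsUsed
    omega

theorem stmt3 {V : Type*} [Fintype V] (G : SimpleGraph V) (hG : G.Connected)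
    (hn : 3 < Fintype.card V) (hcompl : IsKConnected Gᶜ 4) :
    (tmc G : ℤ) = (G.edgeSet.ncard : ℤ) - (Fintype.card V : ℤ) + 2 + (maxLeaves G : ℤ) := by
  have hne : {k | ∃ T : SimpleGraph V, T ≤ G ∧ T.IsTree ∧ numLeaves T = k}.Nonempty := by
    obtain ⟨T, h1, h2⟩ := hG.exists_isTree_le
    exact ⟨_, T, h1, h2, rfl⟩
  obtain ⟨T, hTG, hT, hTl⟩ := Nat.sSup_mem hne (maxLeaves_bdd G)
  have hTl' : numLeaves T = maxLeaves G := hTl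
  obtain ⟨ce, cv, hcol, hlow⟩ := lower G hn T hTG hT
  rw [hTl'] at hlow
  have hbd : BddAbove {k | ∃ ce cv, IsTMCColoring G ce cv ∧ colorsUsed G ce cv = k} := by
    refine ⟨((G.edgeSet.ncard : ℤ) - (Fintype.card V : ℤ) + 2 + (maxLeaves G : ℤ)).toNat, ?_⟩
    rintro k ⟨ce', cv', h, rfl⟩
    have := upper G hn hcompl ce' cv' h
    omega
  apply le_antisymm
  · obtain ⟨ce', cv', h, hk⟩ := Nat.sSup_mem (s := {k | ∃ ce cv, IsTMCColoring G ce cv ∧ colorsUsed G ce cv = k})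
      ⟨colorsUsed G ce cv, ce, cv, hcol, rfl⟩ hbd
    have hk' : colorsUsed G ce' cv' = tmc G := hk
    rw [← hk']
    exact upper G hn hcompl ce' cv' h
  · refine hlow.trans ?_
    have : colorsUsed G ce cv ≤ tmc G := le_csSup hbd ⟨ce, cv, hcol, rfl⟩
    exact_mod_cast this
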